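/- arXiv:1712.00314 — 2 statements merged into one kernel-verified Lean document; each statement's English description precedes it below -/
import Mathlib

section
/- Assume moreover that 𝒞 is closed under direct summands and that 𝒞 is a projective generator for 𝒜 (i.e., for every A∈𝒜 there is an exact sequence 0→A'→C→A→0 with C∈𝒞, and Ext^i_𝒜(C,A)=0 for all i≥1, C∈𝒞, A∈𝒜). Then the following are equivalent: (1) every object of 𝒜 lies in 𝒢(𝒞)^{⊥1}; (2) 𝒢(𝒞)⊆𝒢(𝒞)^{⊥1}; (3) 𝒢(𝒞)=𝒞. -/
open CategoryTheory CategoryTheory.Limits CategoryTheory.Abelian ZeroObject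

universe w t v u

variable {A : Type u} [Category.{v} A] [Abelian A]

/-- `f`, `g` form a short exact sequence `0 ⟶ X ⟶ Y ⟶ Z ⟶ 0` in `A`. -/
def IsSES {X Y Z : A} (f : X ⟶ Y) (g : Y ⟶ Z) : Prop :=
  ∃ hw : f ≫ g = 0, (ShortComplex.mk f g hw).ShortExact

/-- The short exact sequence `0 ⟶ X ⟶ Y ⟶ Z ⟶ 0` remains exact after applying
`Hom_A(C, -)` for every `C` in `𝒞`. -/
def HomLeftExact (𝒞 : A → Prop) {X Y Z : A} (f : X ⟶ Y) (g : Y ⟶ Z) : Prop :=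
  ∀ ⦃C : A⦄, 𝒞 C →
    Function.Injective (fun h : C ⟶ X => h ≫ f) ∧
    Function.Exact (fun h : C ⟶ X => h ≫ f) (fun h : C ⟶ Y => h ≫ g) ∧
    Function.Surjective (fun h : C ⟶ Y => h ≫ g)

/-- The short exact sequence `0 ⟶ X ⟶ Y ⟶ Z ⟶ 0` remains exact after applying
`Hom_A(-, C)` for every `C` in `𝒞`. -/
def HomRightExact (𝒞 : A → Prop) {X Y Z : A} (f : X ⟶ Y) (g : Y ⟶ Z) : Prop :=
  ∀ ⦃C : A⦄, 𝒞 C →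
    Function.Injective (fun h : Z ⟶ C => g ≫ h) ∧
    Function.Exact (fun h : Z ⟶ C => g ≫ h) (fun h : Y ⟶ C => f ≫ h) ∧
    Function.Surjective (fun h : Y ⟶ C => f ≫ h)

/-- `M` belongs to the Gorenstein subcategory `𝒢(𝒞)`: there is an exact sequence
`⋯ ⟶ C_1 ⟶ C_0 ⟶ C^0 ⟶ C^1 ⟶ ⋯` with all terms in `𝒞`, which remains exact after
applying `Hom_A(C,-)` and `Hom_A(-,C)` for every `C ∈ 𝒞`, such that
`M ≅ Im(C_0 ⟶ C^0)`. -/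
def IsGorenstein (𝒞 : A → Prop) (M : A) : Prop :=
  ∃ (X : ℤ → A) (d : ∀ n : ℤ, X n ⟶ X (n + 1)) (hw : ∀ n, d n ≫ d (n + 1) = 0),
    (∀ n, 𝒞 (X n)) ∧
    (∀ n, (ShortComplex.mk (d n) (d (n + 1)) (hw n)).Exact) ∧
    (∀ (n : ℤ) ⦃C : A⦄, 𝒞 C →
      Function.Exact (fun h : C ⟶ X n => h ≫ d n) (fun h : C ⟶ X (n + 1) => h ≫ d (n + 1))) ∧
    (∀ (n : ℤ) ⦃C : A⦄, 𝒞 C →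
      Function.Exact (fun h : X (n + 1 + 1) ⟶ C => d (n + 1) ≫ h)
        (fun h : X (n + 1) ⟶ C => d n ≫ h)) ∧
    Nonempty (M ≅ Limits.image (d 0))

/-- `𝒞` is a full additive subcategory closed under isomorphisms, encoded as a predicate
closed under isomorphisms, containing a zero object and closed under binary biproducts. -/
def IsAdditiveClosed (𝒞 : A → Prop) : Prop :=
  (∀ ⦃X Y : A⦄, (X ≅ Y) → 𝒞 X → 𝒞 Y) ∧ 𝒞 (0 : A) ∧ ∀ ⦃X Y : A⦄, 𝒞 X → 𝒞 Y → 𝒞 (X ⊞ Y)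

/-- `𝒫(A)` is a generator for `𝒞`: for every `C ∈ 𝒞` there is a short exact sequence
`0 ⟶ C' ⟶ P ⟶ C ⟶ 0` with `P` projective and `C' ∈ 𝒞`. -/
def ProjIsGeneratorFor (𝒞 : A → Prop) : Prop :=
  ∀ ⦃C : A⦄, 𝒞 C → ∃ (C' P : A) (f : C' ⟶ P) (g : P ⟶ C),
    Projective P ∧ 𝒞 C' ∧ IsSES f g

section Ext

variable [HasExt.{w} A]

/-- `𝒞` is self-orthogonal: `Ext^i(C, C') = 0` for all `i ≥ 1` and `C, C' ∈ 𝒞`. -/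
def SelfOrthogonal (𝒞 : A → Prop) : Prop :=
  ∀ ⦃C C' : A⦄, 𝒞 C → 𝒞 C' → ∀ i : ℕ, 1 ≤ i → Subsingleton (Abelian.Ext C C' i)

/-- `M ∈ 𝒢(𝒞)^{⊥1}`, i.e. `Ext^1(G, M) = 0` for every `G ∈ 𝒢(𝒞)`. -/
def RightPerp1 (𝒞 : A → Prop) (M : A) : Prop :=
  ∀ ⦃G : A⦄, IsGorenstein 𝒞 G → Subsingleton (Abelian.Ext G M 1)

/-- `f : G ⟶ M` is a special `𝒢(𝒞)`-precover of `M`. -/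
def IsSpecialPrecover (𝒞 : A → Prop) {G M : A} (f : G ⟶ M) : Prop :=
  IsGorenstein 𝒞 G ∧ Epi f ∧ RightPerp1 𝒞 (kernel f) ∧
    ∀ ⦃G' : A⦄, IsGorenstein 𝒞 G' → Function.Surjective (fun h : G' ⟶ G => h ≫ f)

/-- `M` belongs to the special precovered category `spc(𝒢(𝒞))`. -/
def HasSpecialPrecover (𝒞 : A → Prop) (M : A) : Prop :=
  ∃ (G : A) (f : G ⟶ M), IsSpecialPrecover 𝒞 f

/-- `𝒞` is a generator for `𝒢(𝒞)^{⊥1}`. -/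
def GeneratorForPerp (𝒞 : A → Prop) : Prop :=
  ∀ ⦃T : A⦄, RightPerp1 𝒞 T → ∃ (T' C : A) (f : T' ⟶ C) (g : C ⟶ T),
    𝒞 C ∧ RightPerp1 𝒞 T' ∧ IsSES f g

end Ext

/-- The image of a differential embeds in the next term of an exact sequence with cokernel
the image of the next differential. -/
lemma shortExact_image {X Y Z : A} {f : X ⟶ Y} {g : Y ⟶ Z} (w : f ≫ g = 0)
    (h : (ShortComplex.mk f g w).Exact) :
    ∃ w' : Limits.image.ι f ≫ factorThruImage g = 0,
      (ShortComplex.mk (Limits.image.ι f) (factorThruImage g) w').ShortExact := by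
  have w₁ : f ≫ factorThruImage g = 0 := by
    rw [← cancel_mono (Limits.image.ι g)]
    simp [w]
  have w₂ : Limits.image.ι f ≫ factorThruImage g = 0 := by
    rw [← cancel_epi (factorThruImage f)]
    simp [w₁]
  refine ⟨w₂, { exact := ?_ }⟩
  let φ : ShortComplex.mk f (factorThruImage g) w₁ ⟶ ShortComplex.mk f g w :=
    { τ₁ := 𝟙 _, τ₂ := 𝟙 _, τ₃ := Limits.image.ι g }
  let ψ : ShortComplex.mk f (factorThruImage g) w₁ ⟶
      ShortComplex.mk (Limits.image.ι f) (factorThruImage g) w₂ :=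
    { τ₁ := factorThruImage f, τ₂ := 𝟙 _, τ₃ := 𝟙 _ }
  have : Epi φ.τ₁ := by dsimp [φ]; infer_instance
  have : IsIso φ.τ₂ := by dsimp [φ]; infer_instance
  have : Mono φ.τ₃ := by dsimp [φ]; infer_instance
  have : Epi ψ.τ₁ := by dsimp [ψ]; infer_instance
  have : IsIso ψ.τ₂ := by dsimp [ψ]; infer_instance
  have : Mono ψ.τ₃ := by dsimp [ψ]; infer_instance
  rw [← ShortComplex.exact_iff_of_epi_of_isIso_of_mono ψ,
    ShortComplex.exact_iff_of_epi_of_isIso_of_mono φ]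
  exact h

/-- A short exact sequence splits if the first extension group of its outer terms vanishes. -/
lemma nonempty_splitting_of_subsingleton_ext [HasExt.{w} A] {S : ShortComplex A}
    (hS : S.ShortExact) [Subsingleton (Abelian.Ext S.X₃ S.X₁ 1)] : Nonempty S.Splitting := by
  obtain ⟨x, hx⟩ := Abelian.Ext.contravariant_sequence_exact₁ hS S.X₁
    (Abelian.Ext.mk₀ (𝟙 S.X₁)) (n₁ := 1) rfl (Subsingleton.elim _ _)
  obtain ⟨r, rfl⟩ := (Abelian.Ext.mk₀_bijective _ _).2 x
  rw [Abelian.Ext.mk₀_comp_mk₀] at hx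
  exact ⟨.ofExactOfRetraction S hS.exact r ((Abelian.Ext.mk₀_bijective _ _).1 hx) hS.epi_g⟩

/-- Every object of `𝒞` is Gorenstein, as the sequence `⋯ ⟶ M ⊞ M ⟶ M ⊞ M ⟶ ⋯` with
differential `(x, y) ↦ (0, x)` shows. -/
lemma isGorenstein_of_mem {𝒞 : A → Prop} (hadd : IsAdditiveClosed 𝒞) {M : A} (hM : 𝒞 M) :
    IsGorenstein 𝒞 M := by
  let d : M ⊞ M ⟶ M ⊞ M := biprod.fst ≫ biprod.inr
  have hd : d ≫ d = 0 := by simp [d]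
  have key : ∀ {T : A} (h : T ⟶ M ⊞ M), h ≫ d = 0 → ∃ k : T ⟶ M ⊞ M, k ≫ d = h := by
    intro T h hh
    have h₁ : h ≫ biprod.fst = 0 := by
      rw [← cancel_mono (biprod.inr : M ⟶ M ⊞ M)]
      simpa [d] using hh
    refine ⟨biprod.lift (h ≫ biprod.snd) 0, ?_⟩
    ext <;> simp [d, h₁]
  refine ⟨fun _ => M ⊞ M, fun _ => d, fun _ => hd, fun _ => hadd.2.2 hM hM, fun _ => ?_,
    fun _ C _ h => ⟨key h, ?_⟩, fun _ C _ h => ⟨fun hh => ?_, ?_⟩, ⟨?_⟩⟩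
  · rw [ShortComplex.exact_iff_exact_up_to_refinements]
    intro T x hx
    obtain ⟨k, hk⟩ := key x hx
    exact ⟨T, 𝟙 _, inferInstance, k, by simpa using hk.symm⟩
  · rintro ⟨k, rfl⟩
    simp [hd]
  · have h₁ : biprod.inr ≫ h = 0 := by
      rw [← cancel_epi (biprod.fst : M ⊞ M ⟶ M)]
      simpa [d] using hh
    refine ⟨biprod.snd ≫ biprod.inl ≫ h, ?_⟩
    ext <;> simp [d, h₁]
  · rintro ⟨k, rfl⟩
    simp [reassoc_of% hd]
  · exact image.isoStrongEpiMono biprod.fst biprod.inr rfl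

/-- Every Gorenstein object embeds in an object of `𝒞` with Gorenstein cokernel. -/
lemma IsGorenstein.exists_shortExact {𝒞 : A → Prop} {M : A} (hM : IsGorenstein 𝒞 M) :
    ∃ S : ShortComplex A, S.ShortExact ∧ Nonempty (M ≅ S.X₁) ∧ IsGorenstein 𝒞 S.X₁ ∧ 𝒞 S.X₂ ∧
      IsGorenstein 𝒞 S.X₃ := by
  obtain ⟨X, d, hw, hX, hex, hl, hr, e⟩ := hM
  obtain ⟨_, hS⟩ := shortExact_image (hw 0) (hex 0)
  exact ⟨_, hS, e, ⟨X, d, hw, hX, hex, hl, hr, ⟨Iso.refl _⟩⟩, hX _, fun n => X (n + 1), fun n => d (n + 1), fun n => hw (n + 1),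
    fun n => hX _, fun n => hex _, fun n => hl _, fun n => hr _, ⟨Iso.refl _⟩⟩

/-- if moreover `𝒞` is closed under direct summands and is a projective
generator for `A`, then the following are equivalent: (1) `𝒢(𝒞)^{⊥1} = A`;
(2) `𝒢(𝒞) ⊆ 𝒢(𝒞)^{⊥1}`; (3) `𝒢(𝒞) = 𝒞`. -/
theorem stmt_7 [HasExt.{w} A] (𝒞 : A → Prop) (hadd : IsAdditiveClosed 𝒞)
    (hso : SelfOrthogonal 𝒞) (hgen : ProjIsGeneratorFor 𝒞)
    (hsummand : ∀ ⦃X Y : A⦄, 𝒞 (X ⊞ Y) → 𝒞 X)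
    (hCgenA : ∀ X : A, ∃ (K C : A) (f : K ⟶ C) (g : C ⟶ X), 𝒞 C ∧ IsSES f g)
    (hCproj : ∀ ⦃C : A⦄, 𝒞 C → ∀ (X : A) (i : ℕ), 1 ≤ i →
      Subsingleton (Abelian.Ext C X i)) :
    ((∀ M : A, RightPerp1 𝒞 M) ↔ (∀ ⦃G : A⦄, IsGorenstein 𝒞 G → RightPerp1 𝒞 G)) ∧
    ((∀ ⦃G : A⦄, IsGorenstein 𝒞 G → RightPerp1 𝒞 G) ↔
      (∀ M : A, IsGorenstein 𝒞 M ↔ 𝒞 M)) := by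
  have h₁₂ : (∀ M : A, RightPerp1 𝒞 M) → ∀ ⦃G : A⦄, IsGorenstein 𝒞 G → RightPerp1 𝒞 G :=
    fun h G _ => h G
  have h₂₃ : (∀ ⦃G : A⦄, IsGorenstein 𝒞 G → RightPerp1 𝒞 G) →
      ∀ M : A, IsGorenstein 𝒞 M ↔ 𝒞 M := by
    refine fun h M => ⟨fun hM => ?_, isGorenstein_of_mem hadd⟩
    obtain ⟨S, hS, ⟨e⟩, h₁, h₂, h₃⟩ := hM.exists_shortExact
    have := h h₁ h₃
    obtain ⟨s⟩ := nonempty_splitting_of_subsingleton_ext hS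
    exact hadd.1 e.symm (hsummand (hadd.1 s.isoBinaryBiproduct h₂))
  have h₃₁ : (∀ M : A, IsGorenstein 𝒞 M ↔ 𝒞 M) → ∀ M : A, RightPerp1 𝒞 M :=
    fun h M G hG => hCproj ((h G).1 hG) M 1 le_rfl
  exact ⟨⟨h₁₂, h₃₁ ∘ h₂₃⟩, ⟨h₂₃, h₁₂ ∘ h₃₁⟩⟩
end

section
/- Let 0→M'→C→M→0 be a short exact sequence in 𝒜 with C∈𝒞. If M' admits a special 𝒢(𝒞)-precover, then M admits a special 𝒢(𝒞)-precover. -/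
open CategoryTheory CategoryTheory.Limits CategoryTheory.Abelian ZeroObject

universe w t v u

variable {A : Type u} [Category.{v} A] [Abelian A]

/-- `X`, `d` is an exact complex with terms in `𝒞` that stays exact under `Hom(C, -)` and
`Hom(-, C)` for all `C` in `𝒞`. -/
structure IsCompleteResolution (𝒞 : A → Prop) (X : ℤ → A) (d : ∀ n : ℤ, X n ⟶ X (n + 1)) :
    Prop where
  comp : ∀ n, d n ≫ d (n + 1) = 0
  mem : ∀ n, 𝒞 (X n)
  exact : ∀ n, (ShortComplex.mk (d n) (d (n + 1)) (comp n)).Exact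
  homLeft : ∀ (n : ℤ) ⦃C : A⦄, 𝒞 C →
    Function.Exact (fun h : C ⟶ X n => h ≫ d n) (fun h : C ⟶ X (n + 1) => h ≫ d (n + 1))
  homRight : ∀ (n : ℤ) ⦃C : A⦄, 𝒞 C →
    Function.Exact (fun h : X (n + 1 + 1) ⟶ C => d (n + 1) ≫ h)
      (fun h : X (n + 1) ⟶ C => d n ≫ h)

theorem isGorenstein_iff {𝒞 : A → Prop} {M : A} :
    IsGorenstein 𝒞 M ↔ ∃ (X : ℤ → A) (d : ∀ n : ℤ, X n ⟶ X (n + 1)),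
      IsCompleteResolution 𝒞 X d ∧ Nonempty (M ≅ Limits.image (d 0)) :=
  ⟨fun ⟨X, d, hw, h₁, h₂, h₃, h₄, h₅⟩ => ⟨X, d, ⟨hw, h₁, h₂, h₃, h₄⟩, h₅⟩,
    fun ⟨X, d, ⟨hw, h₁, h₂, h₃, h₄⟩, h₅⟩ => ⟨X, d, hw, h₁, h₂, h₃, h₄, h₅⟩⟩

namespace IsCompleteResolution

variable {𝒞 : A → Prop} {X : ℤ → A} {d : ∀ n : ℤ, X n ⟶ X (n + 1)}

theorem exists_shift (h : IsCompleteResolution 𝒞 X d) (k l : ℤ) :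
    ∃ (X' : ℤ → A) (d' : ∀ n : ℤ, X' n ⟶ X' (n + 1)),
      IsCompleteResolution 𝒞 X' d' ∧ Nonempty (Limits.image (d k) ≅ Limits.image (d' l)) := by
  let e : ∀ m m' : ℤ, m + 1 = m' → (X m ⟶ X m') := fun m m' hm => d m ≫ eqToHom (by rw [hm])
  have e_rfl : ∀ m, e m (m + 1) rfl = d m := fun m => by simp [e]
  clear_value e
  have comp : ∀ m m' m'' (hm : m + 1 = m') (hm' : m' + 1 = m''),
      e m m' hm ≫ e m' m'' hm' = 0 := by
    rintro m _ _ rfl rfl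
    simpa only [e_rfl] using h.comp m
  have shift : ∀ n, n + (k - l) + 1 = n + 1 + (k - l) := fun n => by ring
  refine ⟨fun n => X (n + (k - l)), fun n => e _ _ (shift n),
    ⟨fun n => comp _ _ _ (shift n) (shift (n + 1)), fun n => h.mem _, fun n => ?_, fun n C hC => ?_,
      fun n C hC => ?_⟩, ?_⟩
  · have : ∀ m m' m'' (hm : m + 1 = m') (hm' : m' + 1 = m''),
        (ShortComplex.mk (e m m' hm) (e m' m'' hm') (comp _ _ _ hm hm')).Exact := by
      rintro m _ _ rfl rfl
      simpa only [e_rfl] using h.exact m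
    exact this _ _ _ (shift n) (shift (n + 1))
  · have : ∀ m m' m'' (hm : m + 1 = m') (hm' : m' + 1 = m''),
        Function.Exact (fun h : C ⟶ X m => h ≫ e m m' hm)
          (fun h : C ⟶ X m' => h ≫ e m' m'' hm') := by
      rintro m _ _ rfl rfl
      simpa only [e_rfl] using h.homLeft m hC
    exact this _ _ _ (shift n) (shift (n + 1))
  · have : ∀ m m' m'' (hm : m + 1 = m') (hm' : m' + 1 = m''),
        Function.Exact (fun h : X m'' ⟶ C => e m' m'' hm' ≫ h)
          (fun h : X m' ⟶ C => e m m' hm ≫ h) := by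
      rintro m _ _ rfl rfl
      simpa only [e_rfl] using h.homRight m hC
    exact this _ _ _ (shift n) (shift (n + 1))
  · have : ∀ m m' (hm : m + 1 = m'), k = m →
        Nonempty (Limits.image (d k) ≅ Limits.image (e m m' hm)) := by
      rintro m _ rfl rfl
      rw [e_rfl]
      exact ⟨Iso.refl _⟩
    exact this _ _ _ (by ring)

theorem isGorenstein_image (h : IsCompleteResolution 𝒞 X d) (k : ℤ) :
    IsGorenstein 𝒞 (Limits.image (d k)) :=
  isGorenstein_iff.2 (h.exists_shift k 0)

theorem shortExact (h : IsCompleteResolution 𝒞 X d) (n : ℤ) :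
    IsSES (Limits.image.ι (d n)) (factorThruImage (d (n + 1))) := by
  have hw : Limits.image.ι (d n) ≫ factorThruImage (d (n + 1)) = 0 := by
    simp [← cancel_epi (factorThruImage (d n)), ← cancel_mono (Limits.image.ι (d (n + 1))), h.comp n]
  refine ⟨hw, ⟨?_⟩⟩
  rw [ShortComplex.exact_iff_exact_up_to_refinements]
  intro T x hx
  obtain ⟨T', π, hπ, y, hy⟩ := (h.exact n).exact_up_to_refinements x (by
    have := hx =≫ Limits.image.ι (d (n + 1))
    simpa using this)
  exact ⟨T', π, hπ, y ≫ factorThruImage (d n), by simpa using hy⟩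

theorem exists_extension (h : IsCompleteResolution 𝒞 X d) (n : ℤ) {C : A} (hC : 𝒞 C)
    (u : Limits.image (d (n + 1)) ⟶ C) :
    ∃ v : X (n + 1 + 1) ⟶ C, Limits.image.ι (d (n + 1)) ≫ v = u := by
  obtain ⟨v, hv⟩ := (h.homRight n hC (factorThruImage (d (n + 1)) ≫ u)).1 (by
    have : d n ≫ factorThruImage (d (n + 1)) = 0 := by
      simp [← cancel_mono (Limits.image.ι (d (n + 1))), h.comp n]
    simp [reassoc_of% this])
  refine ⟨v, ?_⟩
  rw [← cancel_epi (factorThruImage (d (n + 1)))]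
  simpa using hv

theorem biprod {Y : ℤ → A} {e : ∀ n : ℤ, Y n ⟶ Y (n + 1)} (hadd : IsAdditiveClosed 𝒞)
    (hX : IsCompleteResolution 𝒞 X d) (hY : IsCompleteResolution 𝒞 Y e) :
    IsCompleteResolution 𝒞 (fun n => X n ⊞ Y n) (fun n => biprod.map (d n) (e n)) where
  comp n := by ext <;> simp [hX.comp n, hY.comp n]
  mem n := hadd.2.2 (hX.mem n) (hY.mem n)
  exact n := by
    rw [ShortComplex.exact_iff_exact_up_to_refinements]
    intro T x hx
    obtain ⟨T', π, hπ, y, hy⟩ := (hX.exact n).exact_up_to_refinements (x ≫ biprod.fst) (by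
      have := hx =≫ biprod.fst
      simpa using this)
    obtain ⟨T'', π', hπ', z, hz⟩ :=
      (hY.exact n).exact_up_to_refinements (π ≫ x ≫ biprod.snd) (by
        have := hx =≫ biprod.snd
        simp only [Category.assoc, biprod.map_snd, zero_comp] at this
        simp [this])
    refine ⟨T'', π' ≫ π, inferInstance, biprod.lift (π' ≫ y) z, ?_⟩
    dsimp at hy hz ⊢
    ext
    · simp [hy]
    · simp [hz]
  homLeft n C hC x := by
    refine ⟨fun hx => ?_, ?_⟩
    · obtain ⟨y, hy⟩ := (hX.homLeft n hC (x ≫ biprod.fst)).1 (by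
        have := hx =≫ biprod.fst
        simpa using this)
      obtain ⟨z, hz⟩ := (hY.homLeft n hC (x ≫ biprod.snd)).1 (by
        have := hx =≫ biprod.snd
        simpa using this)
      refine ⟨biprod.lift y z, ?_⟩
      dsimp at hy hz ⊢
      ext
      · simp [hy]
      · simp [hz]
    · rintro ⟨y, rfl⟩
      ext <;> simp [hX.comp n, hY.comp n]
  homRight n C hC x := by
    refine ⟨fun hx => ?_, ?_⟩
    · obtain ⟨y, hy⟩ := (hX.homRight n hC (biprod.inl ≫ x)).1 (by
        have := biprod.inl ≫= hx
        simpa using this)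
      obtain ⟨z, hz⟩ := (hY.homRight n hC (biprod.inr ≫ x)).1 (by
        have := biprod.inr ≫= hx
        simpa using this)
      refine ⟨biprod.desc y z, ?_⟩
      dsimp at hy hz ⊢
      ext
      · simp [hy]
      · simp [hz]
    · rintro ⟨y, rfl⟩
      ext <;> simp [reassoc_of% (hX.comp n), reassoc_of% (hY.comp n)]

/-- The complex that is constantly `C`, with differentials alternating between `𝟙 C` and `0`. -/
theorem alternating {C : A} (hC : 𝒞 C) :
    IsCompleteResolution 𝒞 (fun _ => C) (fun n => if Even n then 𝟙 C else 0) where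
  comp n := by by_cases hn : Even n <;> simp [hn]
  mem _ := hC
  exact n := by
    rw [ShortComplex.exact_iff_exact_up_to_refinements]
    intro T x hx
    by_cases hn : Even n
    · exact ⟨T, 𝟙 T, inferInstance, x, by simp [hn]⟩
    · have hn' : Even (n + 1) := Int.even_add_one.2 hn
      exact ⟨T, 𝟙 T, inferInstance, 0, by simpa [hn, hn'] using hx⟩
  homLeft n D _ x := by
    by_cases hn : Even n
    · have hn' : ¬Even (n + 1) := fun h => Int.even_add_one.1 h hn
      simp [hn, hn']
    · have hn' : Even (n + 1) := Int.even_add_one.2 hn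
      simp [hn, hn']
  homRight n D _ x := by
    by_cases hn : Even n
    · have hn' : ¬Even (n + 1) := fun h => Int.even_add_one.1 h hn
      simp [hn, hn']
    · have hn' : Even (n + 1) := Int.even_add_one.2 hn
      simp [hn, hn']

end IsCompleteResolution

namespace IsGorenstein

variable {𝒞 : A → Prop} {M N : A}

theorem of_iso (h : IsGorenstein 𝒞 M) (i : M ≅ N) : IsGorenstein 𝒞 N := by
  obtain ⟨X, d, h, ⟨j⟩⟩ := isGorenstein_iff.1 h
  exact isGorenstein_iff.2 ⟨X, d, h, ⟨i.symm ≪≫ j⟩⟩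

theorem exists_resolution (h : IsGorenstein 𝒞 M) (k : ℤ) :
    ∃ (X : ℤ → A) (d : ∀ n : ℤ, X n ⟶ X (n + 1)),
      IsCompleteResolution 𝒞 X d ∧ Nonempty (M ≅ Limits.image (d k)) := by
  obtain ⟨X, d, h, ⟨i⟩⟩ := isGorenstein_iff.1 h
  obtain ⟨X', d', h', ⟨j⟩⟩ := h.exists_shift 0 k
  exact ⟨X', d', h', ⟨i ≪≫ j⟩⟩

theorem of_mem {C : A} (hC : 𝒞 C) : IsGorenstein 𝒞 C := by
  refine isGorenstein_iff.2 ⟨_, _, .alternating hC, ⟨?_⟩⟩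
  exact (image.isoStrongEpiMono (𝟙 C) (𝟙 C) (by simp))

theorem biprod (hadd : IsAdditiveClosed 𝒞) (hM : IsGorenstein 𝒞 M) (hN : IsGorenstein 𝒞 N) :
    IsGorenstein 𝒞 (M ⊞ N) := by
  obtain ⟨X, d, hX, ⟨i⟩⟩ := isGorenstein_iff.1 hM
  obtain ⟨Y, e, hY, ⟨j⟩⟩ := isGorenstein_iff.1 hN
  refine isGorenstein_iff.2 ⟨_, _, hX.biprod hadd hY, ⟨biprod.mapIso i j ≪≫ ?_⟩⟩
  haveI := strongEpi_of_epi (biprod.map (factorThruImage (d 0)) (factorThruImage (e 0)))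
  exact image.isoStrongEpiMono (biprod.map (factorThruImage (d 0)) (factorThruImage (e 0)))
    (biprod.map (Limits.image.ι (d 0)) (Limits.image.ι (e 0))) (by ext <;> simp)

/-- A Gorenstein object is a quotient of an object of `𝒞` with Gorenstein kernel, and the
sequence is `Hom(-, 𝒞)`-exact. -/
theorem exists_ses_left (h : IsGorenstein 𝒞 M) :
    ∃ (K P : A) (i : K ⟶ P) (p : P ⟶ M), IsGorenstein 𝒞 K ∧ 𝒞 P ∧ IsSES i p ∧
      ∀ ⦃C : A⦄, 𝒞 C → ∀ u : K ⟶ C, ∃ v : P ⟶ C, i ≫ v = u := by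
  have k : ℤ := 0
  obtain ⟨X, d, h, ⟨j⟩⟩ := h.exists_resolution (k + 1 + 1)
  obtain ⟨hw, hs⟩ := h.shortExact (k + 1)
  refine ⟨_, _, Limits.image.ι (d (k + 1)), factorThruImage (d (k + 1 + 1)) ≫ j.inv,
    h.isGorenstein_image _, h.mem _, ⟨by simp [reassoc_of% hw], ?_⟩,
    fun C hC u => h.exists_extension k hC u⟩
  exact ShortComplex.shortExact_of_iso
    (ShortComplex.isoMk (S₁ := .mk _ _ hw) (Iso.refl _) (Iso.refl _) j.symm (by simp) (by simp)) hs

/-- A Gorenstein object embeds in an object of `𝒞` with Gorenstein cokernel, and the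
sequence is `Hom(-, 𝒞)`-exact. -/
theorem exists_ses_right (h : IsGorenstein 𝒞 M) :
    ∃ (P L : A) (i : M ⟶ P) (p : P ⟶ L), IsGorenstein 𝒞 L ∧ 𝒞 P ∧ IsSES i p ∧
      ∀ ⦃C : A⦄, 𝒞 C → ∀ u : M ⟶ C, ∃ v : P ⟶ C, i ≫ v = u := by
  have k : ℤ := 0
  obtain ⟨X, d, h, ⟨j⟩⟩ := h.exists_resolution (k + 1)
  obtain ⟨hw, hs⟩ := h.shortExact (k + 1)
  refine ⟨_, _, j.hom ≫ Limits.image.ι (d (k + 1)), factorThruImage (d (k + 1 + 1)),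
    h.isGorenstein_image _, h.mem _, ⟨by simp [hw], ?_⟩, fun C hC u => ?_⟩
  · exact ShortComplex.shortExact_of_iso
      (ShortComplex.isoMk (S₁ := .mk _ _ hw) j.symm (Iso.refl _) (Iso.refl _) (by simp) (by simp)) hs
  · obtain ⟨v, hv⟩ := h.exists_extension k hC (j.inv ≫ u)
    exact ⟨v, by simp [hv]⟩

end IsGorenstein

namespace CategoryTheory.ShortComplex.ShortExact

variable [HasExt.{w} A] {S : ShortComplex A}

theorem exists_lift_of_subsingleton_ext (hS : S.ShortExact) {G : A}
    (hG : Subsingleton (Ext G S.X₁ 1)) (u : G ⟶ S.X₃) : ∃ v : G ⟶ S.X₂, v ≫ S.g = u := by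
  obtain ⟨v, hv⟩ := Ext.covariant_sequence_exact₃ G hS (Ext.mk₀ u) (zero_add 1)
    (Subsingleton.elim _ _)
  obtain ⟨v, rfl⟩ := (Ext.mk₀_bijective _ _).2 v
  rw [Ext.mk₀_comp_mk₀] at hv
  exact ⟨v, (Ext.mk₀_bijective _ _).1 hv⟩

theorem subsingleton_ext_of_exists_extension (hS : S.ShortExact) [Projective S.X₂] {Y : A}
    (h : ∀ u : S.X₁ ⟶ Y, ∃ v : S.X₂ ⟶ Y, S.f ≫ v = u) : Subsingleton (Ext S.X₃ Y 1) := by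
  refine subsingleton_of_forall_eq 0 fun x => ?_
  obtain ⟨u, rfl⟩ := Ext.contravariant_sequence_exact₃ hS Y x (Ext.eq_zero_of_projective _)
    (add_zero 1)
  obtain ⟨u, rfl⟩ := (Ext.mk₀_bijective _ _).2 u
  obtain ⟨v, rfl⟩ := h u
  rw [← Ext.mk₀_comp_mk₀, hS.extClass_comp_assoc]

end CategoryTheory.ShortComplex.ShortExact

theorem ProjIsGeneratorFor.projective [HasExt.{w} A] {𝒞 : A → Prop} (hgen : ProjIsGeneratorFor 𝒞)
    (hso : SelfOrthogonal 𝒞) {C : A} (hC : 𝒞 C) : Projective C := by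
  obtain ⟨C', P, f, g, hP, hC', hw, hs⟩ := hgen hC
  obtain ⟨s, hs⟩ := hs.exists_lift_of_subsingleton_ext (hso hC hC' 1 le_rfl) (𝟙 C)
  exact Retract.projective ⟨s, g, hs⟩

/-- The morphism `b` induced on cokernels by a map `a` of short exact sequences has, after adding
`g`, the kernel `K'` fitting in a short exact sequence `0 ⟶ kernel p ⟶ P ⟶ K' ⟶ 0`. -/
theorem shortExact_kernel_biprod_desc {G P L M' C M : A} {i : G ⟶ P} {q : P ⟶ L} {f : M' ⟶ C}
    {g : C ⟶ M} {p : G ⟶ M'} {a : P ⟶ C} {b : L ⟶ M} (hiq : IsSES i q) (hfg : IsSES f g)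
    [Epi p] (ha : i ≫ a = p ≫ f) (hb : q ≫ b = a ≫ g) :
    IsSES (kernel.ι p ≫ i)
      (kernel.lift (biprod.desc b g) (biprod.lift q (-a)) (by simp [hb])) := by
  obtain ⟨hw, hs⟩ := hiq
  obtain ⟨hw', hs'⟩ := hfg
  have := hs.mono_f
  have := hs.epi_g
  have := hs'.mono_f
  dsimp at *
  have hw'' : (kernel.ι p ≫ i) ≫
      kernel.lift (biprod.desc b g) (biprod.lift q (-a)) (by simp [hb]) = 0 := by
    rw [← cancel_mono (kernel.ι _)]
    ext <;> simp [hw, ha]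
  refine ⟨hw'', ?_⟩
  have hepi : Epi (kernel.lift (biprod.desc b g) (biprod.lift q (-a)) (by simp [hb])) := by
    rw [epi_iff_surjective_up_to_refinements]
    intro T x
    obtain ⟨T₁, π₁, _, y, hy⟩ :=
      surjective_up_to_refinements_of_epi q (x ≫ kernel.ι _ ≫ biprod.fst)
    have hx : x ≫ kernel.ι (biprod.desc b g) ≫ biprod.fst ≫ b +
        x ≫ kernel.ι (biprod.desc b g) ≫ biprod.snd ≫ g = 0 := by
      have (w : T ⟶ L ⊞ C) : w ≫ biprod.fst ≫ b + w ≫ biprod.snd ≫ g = w ≫ biprod.desc b g := by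
        rw [biprod.desc_eq, Preadditive.comp_add]
      simpa using this (x ≫ kernel.ι _)
    obtain ⟨T₂, π₂, _, m, hm⟩ := hs'.exact.exact_up_to_refinements
      (y ≫ a + π₁ ≫ x ≫ kernel.ι _ ≫ biprod.snd) (by
        have h₁ := hy =≫ b
        have h₂ := π₁ ≫= hx
        simp only [Category.assoc, hb, Preadditive.comp_add, comp_zero] at h₁ h₂
        simpa [← h₁] using h₂)
    obtain ⟨T₃, π₃, _, z, hz⟩ := surjective_up_to_refinements_of_epi p m
    refine ⟨T₃, π₃ ≫ π₂ ≫ π₁, inferInstance, π₃ ≫ π₂ ≫ y - z ≫ i, ?_⟩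
    rw [← cancel_mono (kernel.ι _)]
    dsimp at hm
    ext
    · simp [hy, hw]
    · have h₃ := π₃ ≫= hm
      rw [reassoc_of% hz, Preadditive.comp_add, Preadditive.comp_add] at h₃
      simp only [Category.assoc, kernel.lift_ι, biprod.lift_snd, Preadditive.sub_comp,
        Preadditive.comp_neg, ha, ← h₃]
      abel
  have hexact : (ShortComplex.mk _ _ hw'').Exact := by
    rw [ShortComplex.exact_iff_exact_up_to_refinements]
    intro T y hy
    dsimp at y hy
    have hy₁ : y ≫ q = 0 := by
      have := hy =≫ (kernel.ι _ ≫ biprod.fst)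
      simpa using this
    have hy₂ : y ≫ a = 0 := by
      have := hy =≫ (kernel.ι _ ≫ biprod.snd)
      simpa using this
    obtain ⟨T', π, hπ, z, hz⟩ := hs.exact.exact_up_to_refinements y hy₁
    dsimp at hz
    have hzp : z ≫ p = 0 := by
      rw [← cancel_mono f, Category.assoc, ← ha, ← reassoc_of% hz, hy₂, comp_zero, zero_comp]
    exact ⟨T', π, hπ, kernel.lift p z hzp, by simpa using hz⟩
  exact ⟨hexact⟩

/-- given a short exact sequence `0 ⟶ M' ⟶ C ⟶ M ⟶ 0` with `C ∈ 𝒞`,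
if `M'` admits a special `𝒢(𝒞)`-precover then so does `M`. -/
theorem stmt_9 [HasExt.{w} A] (𝒞 : A → Prop) (hadd : IsAdditiveClosed 𝒞)
    (hso : SelfOrthogonal 𝒞) (hgen : ProjIsGeneratorFor 𝒞)
    {M' C M : A} (f : M' ⟶ C) (g : C ⟶ M) (hC : 𝒞 C) (hses : IsSES f g)
    (h : HasSpecialPrecover 𝒞 M') :
    HasSpecialPrecover 𝒞 M := by
  obtain ⟨G, p, hG, hp, hK, -⟩ := h
  obtain ⟨P, L, i, q, hL, hP, hiq, hext⟩ := hG.exists_ses_right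
  obtain ⟨a, ha⟩ := hext hC (p ≫ f)
  obtain ⟨b, hb⟩ : ∃ b : L ⟶ M, q ≫ b = a ≫ g := by
    obtain ⟨hw, hs⟩ := hiq
    have := hs.epi_g
    have hag : i ≫ a ≫ g = 0 := by
      obtain ⟨hw', -⟩ := hses
      simp [reassoc_of% ha, hw']
    exact ⟨hs.exact.desc (a ≫ g) hag, hs.exact.g_desc (a ≫ g) hag⟩
  obtain ⟨hw₁, hs₁⟩ := shortExact_kernel_biprod_desc hiq hses ha hb
  have hepi : Epi (biprod.desc b g) := by
    obtain ⟨_, hs⟩ := hses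
    have : Epi g := hs.epi_g
    exact epi_of_epi_fac (biprod.inr_desc b g)
  have hperp : RightPerp1 𝒞 (kernel (biprod.desc b g)) := by
    intro G' hG'
    obtain ⟨N, Q, j, r, hN, hQ, ⟨hw₂, hs₂⟩, hext'⟩ := hG'.exists_ses_left
    have : Projective Q := hgen.projective hso hQ
    refine hs₂.subsingleton_ext_of_exists_extension fun u => ?_
    obtain ⟨v, rfl⟩ := hs₁.exists_lift_of_subsingleton_ext (hK hN) u
    obtain ⟨t, rfl⟩ := hext' hP v
    exact ⟨t ≫ _, (Category.assoc _ _ _).symm⟩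
  refine ⟨L ⊞ C, biprod.desc b g, hL.biprod hadd (.of_mem hC), hepi, hperp, fun G' hG' u => ?_⟩
  have hs₃ : (ShortComplex.mk _ _ (kernel.condition (biprod.desc b g))).ShortExact :=
    ⟨ShortComplex.exact_kernel _⟩
  exact hs₃.exists_lift_of_subsingleton_ext (hperp hG') u
end
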